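/- (f_r for the two-mode squeezed vacuum projection.) Let q ∈ ℂ with 0 < |q| < 1 and let r ≥ 1 be a natural number. Then sup{ |⟨Φ_q, ψ⟩|² : ψ ∈ ℓ²(ℕ×ℕ), ‖ψ‖ = 1, ψ = Σ_{k=1}^r x_k ⊗ y_k for some x_k, y_k ∈ ℓ²(ℕ) } = 1 − |q|^{2r}, and the supremum is attained by the vector ψ_r with ψ_r(m,n) = √((1−|q|²)/(1−|q|^{2r}))·qᵐ if m = n < r and 0 otherwise. -/

import Mathlib

noncomputable section

namespace SNpaper

/-- The two-mode squeezed-vacuum vector `Φ_q ∈ ℓ²(ℕ×ℕ)`, as a square-summable function: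
`Φ_q(m,n) = √(1−|q|²) qᵐ` if `m = n`, and `0` otherwise. -/
def Phi (q : ℂ) : ℕ × ℕ → ℂ :=
  fun p => if p.1 = p.2 then (Real.sqrt (1 - ‖q‖ ^ 2) : ℂ) * q ^ p.1 else 0

/-- The normalized truncation `ψ_r` of `Φ_q` to the first `r` Schmidt terms. -/
def PhiTrunc (q : ℂ) (r : ℕ) : ℕ × ℕ → ℂ :=
  fun p => if p.1 = p.2 ∧ p.1 < r then
    (Real.sqrt ((1 - ‖q‖ ^ 2) / (1 - ‖q‖ ^ (2 * r))) : ℂ) * q ^ p.1 else 0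

/-- The diagonal entries `w` of the orthogonal projection onto a finite-dimensional subspace `S` of
`ℓ²(ℕ)` lie in `[0, 1]`, sum up to the dimension of `S`, and control the coordinates of the vectors
in `S`. -/
theorem exists_diagonal_weights (S : Submodule ℂ (lp (fun _ : ℕ => ℂ) 2)) [FiniteDimensional ℂ S] :
    ∃ w : ℕ → ℝ, (∀ n, 0 ≤ w n) ∧ (∀ n, w n ≤ 1) ∧ HasSum w (Module.finrank ℂ S) ∧
      ∀ v ∈ S, ∀ n, ‖v n‖ ≤ √(w n) * ‖v‖ := by
  let δ : ℕ → lp (fun _ : ℕ => ℂ) 2 := fun n => lp.single 2 n 1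
  have hδ (n : ℕ) : ‖δ n‖ = 1 := by simp [δ, lp.norm_single]
  have hinner (v : lp (fun _ : ℕ => ℂ) 2) (n : ℕ) : ‖inner ℂ v (δ n)‖ = ‖v n‖ := by
    simp [δ, lp.inner_single_right]
  let e := stdOrthonormalBasis ℂ S
  have hproj (u : S) (n : ℕ) : inner ℂ u (S.orthogonalProjectionOnto (δ n)) =
      inner ℂ (u : lp (fun _ : ℕ => ℂ) 2) (δ n) := by
    simp
  refine ⟨fun n => ‖S.orthogonalProjectionOnto (δ n)‖ ^ 2, fun n => by positivity, fun n => ?_, ?_, ?_⟩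
  · have h := S.norm_orthogonalProjectionOnto_apply_le (δ n)
    rw [hδ] at h
    exact pow_le_one₀ (norm_nonneg _) h
  · have hw (n : ℕ) : ‖S.orthogonalProjectionOnto (δ n)‖ ^ 2 =
        ∑ j, ‖(e j : lp (fun _ : ℕ => ℂ) 2) n‖ ^ 2 := by
      rw [← e.sum_sq_norm_inner_right]
      simp only [hproj, hinner]
    have he (j) : HasSum (fun n => ‖(e j : lp (fun _ : ℕ => ℂ) 2) n‖ ^ 2) (1 : ℝ) := by
      have h := lp.hasSum_norm (p := 2) (by simp) (e j : lp (fun _ : ℕ => ℂ) 2)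
      have h1 : ‖(e j : lp (fun _ : ℕ => ℂ) 2)‖ = 1 := e.orthonormal.1 j
      simpa [h1] using h
    simp only [hw]
    simpa using hasSum_sum fun j (_ : j ∈ Finset.univ) => he j
  · intro v hv n
    rw [Real.sqrt_sq (norm_nonneg _), mul_comm, ← hinner, ← hproj ⟨v, hv⟩]
    exact norm_inner_le_norm (𝕜 := ℂ) (⟨v, hv⟩ : S) _

/-- Among weights in `[0, 1]` of total mass at most `r`, the sum weighted by a geometric sequence is
largest when the mass sits on the first `r` terms. -/
theorem tsum_geometric_mul_le {x s : ℝ} (hx0 : 0 ≤ x) (hx1 : x < 1) {r : ℕ} {w : ℕ → ℝ}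
    (hw0 : ∀ n, 0 ≤ w n) (hw1 : ∀ n, w n ≤ 1) (hw : HasSum w s) (hs : s ≤ r) :
    ∑' n, (1 - x) * x ^ n * w n ≤ 1 - x ^ r := by
  have hsum : Summable fun n => (1 - x) * x ^ n * w n := by
    refine Summable.of_nonneg_of_le (fun n => ?_) (fun n => ?_)
      ((summable_geometric_of_lt_one hx0 hx1).mul_left (1 - x))
    · exact mul_nonneg (mul_nonneg (by linarith) (by positivity)) (hw0 n)
    · exact mul_le_of_le_one_right (mul_nonneg (by linarith) (by positivity)) (hw1 n)
  let g : ℕ → ℝ := fun n => if n < r then (1 - x) * x ^ n - (1 - x) * x ^ r else 0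
  have hg : HasSum g (∑ n ∈ Finset.range r, g n) :=
    hasSum_sum_of_ne_finset_zero fun n hn => by simp_all [g]
  have hgval : ∑ n ∈ Finset.range r, g n = 1 - x ^ r - (1 - x) * x ^ r * r := by
    rw [Finset.sum_congr rfl fun n hn => if_pos (Finset.mem_range.1 hn), Finset.sum_sub_distrib,
      ← Finset.mul_sum, mul_neg_geom_sum]
    simp [mul_comm]
  have hle : ∑' n, (1 - x) * x ^ n * w n - (1 - x) * x ^ r * s ≤
      1 - x ^ r - (1 - x) * x ^ r * r := by
    rw [← hgval]
    refine hasSum_le (fun n => ?_) (hsum.hasSum.sub (hw.mul_left ((1 - x) * x ^ r))) hg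
    dsimp only [g]
    split_ifs with hn
    · have := pow_le_pow_of_le_one hx0 hx1.le hn.le
      nlinarith [mul_nonneg (mul_nonneg (sub_nonneg.2 hx1.le) (sub_nonneg.2 this))
        (sub_nonneg.2 (hw1 n))]
    · have := pow_le_pow_of_le_one hx0 hx1.le (not_lt.1 hn)
      nlinarith [mul_nonneg (mul_nonneg (sub_nonneg.2 hx1.le) (sub_nonneg.2 this)) (hw0 n)]
  nlinarith [mul_le_mul_of_nonneg_left hs
    (mul_nonneg (sub_nonneg.2 hx1.le) (pow_nonneg hx0 r))]

theorem tsum_eq_tsum_diagonal {α : Type*} [AddCommMonoid α] [TopologicalSpace α] {f : ℕ × ℕ → α}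
    (hf : ∀ p, p.1 ≠ p.2 → f p = 0) : ∑' p, f p = ∑' n, f (n, n) := by
  symm
  refine Function.Injective.tsum_eq (g := fun n : ℕ => (n, n)) (fun a b h => (Prod.mk.inj h).1) ?_
  rintro ⟨m, n⟩ hp
  by_cases h : m = n
  · exact ⟨m, by simp [h]⟩
  · exact absurd (hf (m, n) h) hp

theorem tsum_star_Phi_mul (q : ℂ) (ψ : ℕ × ℕ → ℂ) :
    ∑' p : ℕ × ℕ, star (Phi q p) * ψ p =
      ∑' n : ℕ, star ((√(1 - ‖q‖ ^ 2) : ℂ) * q ^ n) * ψ (n, n) := by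
  rw [tsum_eq_tsum_diagonal fun p hp => by simp [Phi, hp]]
  simp [Phi]

/-- The squared overlap of `Φ_q` with a unit vector of Schmidt rank at most `r` is at most
`1 − |q|^{2r}`. -/
theorem norm_tsum_star_Phi_mul_sq_le {q : ℂ} (h1 : ‖q‖ < 1) {r : ℕ} {ψ : ℕ × ℕ → ℂ}
    (hψ : ∑' p : ℕ × ℕ, ‖ψ p‖ ^ 2 = 1) {x y : Fin r → ℕ → ℂ}
    (hx : ∀ k, Summable fun n => ‖x k n‖ ^ 2) (hxy : ψ = fun p => ∑ k, x k p.1 * y k p.2) :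
    ‖∑' p : ℕ × ℕ, star (Phi q p) * ψ p‖ ^ 2 ≤ 1 - ‖q‖ ^ (2 * r) := by
  have hq : 0 ≤ 1 - ‖q‖ ^ 2 := sub_nonneg.2 (pow_le_one₀ (norm_nonneg q) h1.le)
  have hq1 : ‖q‖ ^ 2 < 1 := pow_lt_one₀ (norm_nonneg q) h1 two_ne_zero
  let X : Fin r → lp (fun _ : ℕ => ℂ) 2 := fun k =>
    ⟨x k, (memℓp_gen_iff (by simp)).2 (by simpa using hx k)⟩
  let S := Submodule.span ℂ (Set.range X)
  have : FiniteDimensional ℂ S := .span_of_finite ℂ (Set.finite_range X)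
  obtain ⟨w, hw0, hw1, hw, hv⟩ := exists_diagonal_weights S
  have hrank : (Module.finrank ℂ S : ℝ) ≤ r := by
    have := finrank_range_le_card (R := ℂ) X
    rw [Fintype.card_fin] at this
    exact_mod_cast this
  let col : ℕ → lp (fun _ : ℕ => ℂ) 2 := fun n => ∑ k, y k n • X k
  have hcol (m n : ℕ) : col n m = ψ (m, n) := by
    simp only [col, hxy, X, lp.coeFn_sum]
    refine (Finset.sum_apply m _ _).trans ?_
    simp [mul_comm]
  have hcolS (n : ℕ) : col n ∈ S :=
    S.sum_mem fun k _ => S.smul_mem _ (Submodule.subset_span ⟨k, rfl⟩)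
  have hnorm (n : ℕ) : HasSum (fun m => ‖ψ (m, n)‖ ^ 2) (‖col n‖ ^ 2) := by
    simpa [hcol] using lp.hasSum_norm (p := 2) (by simp) (col n)
  have hψs : HasSum (fun p => ‖ψ p‖ ^ 2) 1 := by
    rw [← hψ]
    refine Summable.hasSum ?_
    by_contra h
    rw [tsum_eq_zero_of_not_summable h] at hψ
    exact zero_ne_one hψ
  have hcols : HasSum (fun n => ‖col n‖ ^ 2) 1 :=
    ((Equiv.prodComm ℕ ℕ).hasSum_iff.2 hψs).prod_fiberwise hnorm
  let f : ℕ → ℝ := fun n => √(1 - ‖q‖ ^ 2) * ‖q‖ ^ n * √(w n)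
  have hf0 (n : ℕ) : 0 ≤ f n := by positivity
  have hf2 (n : ℕ) : f n ^ 2 = (1 - ‖q‖ ^ 2) * (‖q‖ ^ 2) ^ n * w n := by
    simp only [f, mul_pow, Real.sq_sqrt hq, Real.sq_sqrt (hw0 n), ← pow_mul, mul_comm]
  have hfs : Summable fun n => f n ^ 2 := by
    simp only [hf2]
    refine Summable.of_nonneg_of_le (fun n => ?_) (fun n => ?_)
      ((summable_geometric_of_lt_one (by positivity) hq1).mul_left (1 - ‖q‖ ^ 2))
    · exact mul_nonneg (by positivity) (hw0 n)
    · exact mul_le_of_le_one_right (by positivity) (hw1 n)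
  have hterm (n : ℕ) :
      ‖star ((√(1 - ‖q‖ ^ 2) : ℂ) * q ^ n) * ψ (n, n)‖ ≤ f n * ‖col n‖ := by
    have := hv (col n) (hcolS n) n
    rw [hcol] at this
    rw [norm_mul, norm_star, norm_mul, norm_pow, Complex.norm_real,
      Real.norm_of_nonneg (by positivity)]
    calc _ ≤ √(1 - ‖q‖ ^ 2) * ‖q‖ ^ n * (√(w n) * ‖col n‖) := by gcongr
      _ = f n * ‖col n‖ := by ring
  have hfs' : Summable fun n => f n ^ (2 : ℝ) := by simpa using hfs
  have hcs' : Summable fun n => ‖col n‖ ^ (2 : ℝ) := by simpa using hcols.summable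
  have hfc : Summable fun n => f n * ‖col n‖ :=
    Real.summable_mul_of_Lp_Lq_of_nonneg Real.HolderConjugate.two_two hf0
      (fun n => norm_nonneg _) hfs' hcs'
  have hCS := Real.inner_le_Lp_mul_Lq_tsum_of_nonneg Real.HolderConjugate.two_two hf0
    (fun n => norm_nonneg (col n)) hfs' hcs'
  simp only [Real.rpow_two, hcols.tsum_eq, ← Real.sqrt_eq_rpow, Real.sqrt_one, mul_one] at hCS
  rw [tsum_star_Phi_mul]
  calc _ ≤ √(∑' n, f n ^ 2) ^ 2 :=
        pow_le_pow_left₀ (norm_nonneg _)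
          ((tsum_of_norm_bounded hfc.hasSum hterm).trans hCS) 2
    _ = ∑' n, f n ^ 2 := Real.sq_sqrt (tsum_nonneg fun n => sq_nonneg _)
    _ ≤ 1 - (‖q‖ ^ 2) ^ r := by
        simp only [hf2]
        exact tsum_geometric_mul_le (by positivity) hq1 hw0 hw1 hw hrank
    _ = 1 - ‖q‖ ^ (2 * r) := by rw [pow_mul]

theorem sum_range_norm_sq_pow {q : ℂ} (h1 : ‖q‖ < 1) (r : ℕ) :
    ∑ n ∈ Finset.range r, (‖q‖ ^ n) ^ 2 = (1 - ‖q‖ ^ (2 * r)) / (1 - ‖q‖ ^ 2) := by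
  have hq1 : ‖q‖ ^ 2 < 1 := pow_lt_one₀ (norm_nonneg q) h1 two_ne_zero
  rw [eq_div_iff (sub_ne_zero.2 hq1.ne'), mul_comm, pow_mul, ← mul_neg_geom_sum (‖q‖ ^ 2)]
  simp only [← pow_mul, mul_comm]

theorem tsum_norm_PhiTrunc_sq {q : ℂ} (h1 : ‖q‖ < 1) {r : ℕ} (hr : 1 ≤ r) :
    ∑' p : ℕ × ℕ, ‖PhiTrunc q r p‖ ^ 2 = 1 := by
  have hq1 : 0 < 1 - ‖q‖ ^ 2 := sub_pos.2 (pow_lt_one₀ (norm_nonneg q) h1 two_ne_zero)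
  have hqr : 0 < 1 - ‖q‖ ^ (2 * r) := sub_pos.2 (pow_lt_one₀ (norm_nonneg q) h1 (by lia))
  rw [tsum_eq_tsum_diagonal fun p hp => by simp [PhiTrunc, hp],
    tsum_eq_sum (s := Finset.range r) fun n hn => by simp_all [PhiTrunc]]
  have hterm (n : ℕ) (hn : n ∈ Finset.range r) : ‖PhiTrunc q r (n, n)‖ ^ 2 =
      (1 - ‖q‖ ^ 2) / (1 - ‖q‖ ^ (2 * r)) * (‖q‖ ^ n) ^ 2 := by
    rw [PhiTrunc, if_pos ⟨rfl, Finset.mem_range.1 hn⟩, norm_mul, norm_pow, Complex.norm_real,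
      mul_pow, Real.norm_of_nonneg (by positivity), Real.sq_sqrt (by positivity)]
  rw [Finset.sum_congr rfl hterm, ← Finset.mul_sum, sum_range_norm_sq_pow h1]
  field_simp

theorem norm_tsum_star_Phi_mul_PhiTrunc_sq {q : ℂ} (h1 : ‖q‖ < 1) {r : ℕ} (hr : 1 ≤ r) :
    ‖∑' p : ℕ × ℕ, star (Phi q p) * PhiTrunc q r p‖ ^ 2 = 1 - ‖q‖ ^ (2 * r) := by
  have hq1 : 0 < 1 - ‖q‖ ^ 2 := sub_pos.2 (pow_lt_one₀ (norm_nonneg q) h1 two_ne_zero)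
  have hqr : 0 < 1 - ‖q‖ ^ (2 * r) := sub_pos.2 (pow_lt_one₀ (norm_nonneg q) h1 (by lia))
  rw [tsum_star_Phi_mul, tsum_eq_sum (s := Finset.range r) fun n hn => by simp_all [PhiTrunc]]
  have hterm (n : ℕ) (hn : n ∈ Finset.range r) :
      star ((√(1 - ‖q‖ ^ 2) : ℂ) * q ^ n) * PhiTrunc q r (n, n) =
      ((√(1 - ‖q‖ ^ 2) * √((1 - ‖q‖ ^ 2) / (1 - ‖q‖ ^ (2 * r))) * (‖q‖ ^ n) ^ 2 : ℝ) : ℂ) := by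
    have hc := Complex.conj_mul' (q ^ n)
    rw [norm_pow] at hc
    rw [PhiTrunc, if_pos ⟨rfl, Finset.mem_range.1 hn⟩, star_mul', Complex.star_def,
      Complex.conj_ofReal, mul_mul_mul_comm, hc]
    push_cast
    rfl
  rw [Finset.sum_congr rfl hterm, ← Complex.ofReal_sum, ← Finset.mul_sum,
    sum_range_norm_sq_pow h1, Complex.norm_real, Real.norm_eq_abs, sq_abs, mul_pow, mul_pow,
    Real.sq_sqrt hq1.le, Real.sq_sqrt (by positivity)]
  field_simp

theorem PhiTrunc_eq_sum (q : ℂ) (r : ℕ) : ∃ x y : Fin r → ℕ → ℂ,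
    (∀ k, Summable fun n => ‖x k n‖ ^ 2) ∧ (∀ k, Summable fun n => ‖y k n‖ ^ 2) ∧
      PhiTrunc q r = fun p => ∑ k, x k p.1 * y k p.2 := by
  have hs (k : ℕ) (a : ℂ) : Summable fun n => ‖if n = k then a else 0‖ ^ 2 :=
    summable_of_ne_finset_zero (s := {k}) fun n hn => by simp_all
  refine ⟨fun k n => if n = k then
      (√((1 - ‖q‖ ^ 2) / (1 - ‖q‖ ^ (2 * r))) : ℂ) * q ^ (k : ℕ) else 0,
    fun k n => if n = k then 1 else 0, fun k => hs k _, fun k => hs k 1, ?_⟩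
  ext ⟨m, n⟩
  by_cases hm : m < r
  · rw [Finset.sum_eq_single ⟨m, hm⟩]
    · simp [PhiTrunc, hm, eq_comm]
    · rintro k - hk
      have : m ≠ k := fun h => hk (Fin.ext h.symm)
      simp [this]
    · simp
  · have (k : Fin r) : m ≠ k := by lia
    simp [PhiTrunc, hm, this]

/-- the supremum of `|⟨Φ_q, ψ⟩|²` over unit vectors `ψ ∈ ℓ²(ℕ×ℕ)` of Schmidt
rank at most `r` equals `1 − |q|^{2r}`, and it is attained by the vector `ψ_r` with
`ψ_r(m,n) = √((1−|q|²)/(1−|q|^{2r})) qᵐ` for `m = n < r` and `0` otherwise. -/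
theorem fr_two_mode_squeezed_vacuum (q : ℂ) (h0 : 0 < ‖q‖) (h1 : ‖q‖ < 1)
    (r : ℕ) (hr : 1 ≤ r) :
    sSup { t : ℝ | ∃ ψ : ℕ × ℕ → ℂ,
        (∑' p : ℕ × ℕ, ‖ψ p‖ ^ 2) = 1 ∧
        (∃ (x y : Fin r → ℕ → ℂ),
          (∀ k, Summable fun n => ‖x k n‖ ^ 2) ∧
          (∀ k, Summable fun n => ‖y k n‖ ^ 2) ∧
          ψ = fun p => ∑ k, x k p.1 * y k p.2) ∧
        ‖∑' p : ℕ × ℕ, star (Phi q p) * ψ p‖ ^ 2 = t }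
      = 1 - ‖q‖ ^ (2 * r) ∧
    (∑' p : ℕ × ℕ, ‖PhiTrunc q r p‖ ^ 2) = 1 ∧
    (∃ (x y : Fin r → ℕ → ℂ),
      (∀ k, Summable fun n => ‖x k n‖ ^ 2) ∧
      (∀ k, Summable fun n => ‖y k n‖ ^ 2) ∧
      PhiTrunc q r = fun p => ∑ k, x k p.1 * y k p.2) ∧
    ‖∑' p : ℕ × ℕ, star (Phi q p) * PhiTrunc q r p‖ ^ 2 = 1 - ‖q‖ ^ (2 * r) := by
  have hnorm := tsum_norm_PhiTrunc_sq h1 hr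
  have hover := norm_tsum_star_Phi_mul_PhiTrunc_sq h1 hr
  refine ⟨IsGreatest.csSup_eq ⟨⟨_, hnorm, PhiTrunc_eq_sum q r, hover⟩, ?_⟩, hnorm,
    PhiTrunc_eq_sum q r, hover⟩
  rintro t ⟨ψ, hψ, ⟨x, y, hx, -, hxy⟩, rfl⟩
  exact norm_tsum_star_Phi_mul_sq_le h1 hψ hx hxy

end SNpaper
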